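/- Let τ be either σ or σ⁻¹, let V be a finite-dimensional k̄-vector space, and let Φ : V → V be a τ-linear map. Then there exists a chain of k̄-subspaces 0 = V₀ ⊆ V₁ ⊆ ⋯ ⊆ V_r = V with r = dim_{k̄} V such that Φ(V_i) ⊆ V_i and dim_{k̄}(V_i/V_{i−1}) = 1 for every i = 1, …, r. -/

import Mathlib

open Polynomial in
/-- The solution of the recursion `x₀ = a₀ y ^ q`, `xᵢ₊₁ = xᵢ ^ q + aᵢ₊₁ y ^ q`, as a polynomial
in `y`. -/
noncomputable def twistedCoeff {K : Type*} [Field K] (q : ℕ) (a : ℕ → K) : ℕ → K[X]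
  | 0 => C (a 0) * X ^ q
  | i + 1 => twistedCoeff q a i ^ q + C (a (i + 1)) * X ^ q

open Polynomial in
theorem twistedCoeff_natDegree {K : Type*} [Field K] {q : ℕ} (hq : 1 < q) {a : ℕ → K}
    (ha : a 0 ≠ 0) (i : ℕ) : 1 < (twistedCoeff q a i).natDegree := by
  induction i with
  | zero => simpa [twistedCoeff, natDegree_C_mul_X_pow q (a 0) ha] using hq
  | succ i ih =>
    have hlt : (C (a (i + 1)) * X ^ q).natDegree < (twistedCoeff q a i ^ q).natDegree := by
      rw [natDegree_pow]
      exact (natDegree_C_mul_X_pow_le _ _).trans_lt (by nlinarith)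
    rw [twistedCoeff, natDegree_add_eq_left_of_natDegree_lt hlt, natDegree_pow]
    nlinarith

open Polynomial in
theorem X_sq_dvd_twistedCoeff {K : Type*} [Field K] {q : ℕ} (hq : 1 < q) (a : ℕ → K) (i : ℕ) :
    X ^ 2 ∣ twistedCoeff q a i := by
  have hX : (X ^ 2 : K[X]) ∣ X ^ q := pow_dvd_pow X hq
  induction i with
  | zero => exact hX.mul_left _
  | succ i ih =>
    exact dvd_add (ih.trans (dvd_pow_self _ (by lia))) (hX.mul_left _)

open Polynomial in
theorem exists_ne_zero_eval_twistedCoeff_eq {K : Type*} [Field K] [IsAlgClosed K] {q : ℕ}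
    (hq : 1 < q) {a : ℕ → K} (ha : a 0 ≠ 0) (i : ℕ) :
    ∃ y ≠ 0, (twistedCoeff q a i).eval y = y := by
  obtain ⟨S, hS⟩ := X_sq_dvd_twistedCoeff hq a i
  have hdeg := twistedCoeff_natDegree hq ha i
  have hS0 : S ≠ 0 := by
    rintro rfl
    simp [hS] at hdeg
  have hd : (X * S - C 1).degree ≠ 0 := by
    rw [degree_sub_eq_left_of_degree_lt] <;>
      rw [degree_mul, degree_X, degree_eq_natDegree hS0]
    · norm_cast
      lia
    · rw [degree_C one_ne_zero]
      norm_cast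
      lia
  obtain ⟨y, hy⟩ := IsAlgClosed.exists_root _ hd
  have hy1 : y * S.eval y = 1 := by simpa [sub_eq_zero] using hy
  refine ⟨y, left_ne_zero_of_mul_eq_one hy1, ?_⟩
  simp only [hS, eval_mul, eval_pow, eval_X]
  linear_combination y * hy1

/-- In a sequence of vectors of a finite-dimensional space, some term lies in the span of the
previous ones. -/
theorem exists_eq_sum_range_smul {K V : Type*} [Field K] [AddCommGroup V] [Module K V]
    [FiniteDimensional K V] (u : ℕ → V) :
    ∃ m, ∃ a : ℕ → K, u m = ∑ i ∈ Finset.range m, a i • u i := by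
  let S : ℕ →o Submodule K V :=
    ⟨fun m => Submodule.span K (u '' (Finset.range m : Set ℕ)), fun m n h =>
      Submodule.span_mono (Set.image_mono (by simpa using h))⟩
  obtain ⟨m, hm⟩ := monotone_stabilizes_iff_noetherian.2 (inferInstance : IsNoetherian K V) S
  have hu : u m ∈ S m := by
    rw [hm (m + 1) m.le_succ]
    exact Submodule.subset_span ⟨m, by simp, rfl⟩
  obtain ⟨a, ha⟩ := (Submodule.mem_span_image_finset_iff_exists_fun' K).1 hu
  exact ⟨m, a, ha.symm⟩

/-- An injective Frobenius-linear endomorphism of a nonzero finite-dimensional vector space over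
an algebraically closed field has a nonzero fixed vector. -/
theorem exists_fixed_of_injective_frobenius_linear {K V : Type*} [Field K] [IsAlgClosed K]
    {q : ℕ} (hq : 1 < q) (σ : K ≃+* K) (hσ : ∀ x, σ x = x ^ q)
    [AddCommGroup V] [Module K V] [FiniteDimensional K V] [Nontrivial V]
    (f : V →ₛₗ[(σ : K →+* K)] V) (hf : Function.Injective f) : ∃ v ≠ 0, f v = v := by
  classical
  obtain ⟨v, hv⟩ := exists_ne (0 : V)
  let u : ℕ → V := fun i => f^[i] v
  have hu : ∀ i, f (u i) = u (i + 1) := fun i => (Function.iterate_succ_apply' f i v).symm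
  have hex := exists_eq_sum_range_smul (K := K) u
  obtain ⟨a, ha⟩ := Nat.find_spec hex
  have hmin : ∀ k < Nat.find hex, ∀ b : ℕ → K, u k ≠ ∑ i ∈ Finset.range k, b i • u i :=
    fun k hk b hb => Nat.find_min hex hk ⟨b, hb⟩
  generalize Nat.find hex = m at ha hmin
  cases m with
  | zero => exact absurd (by simpa [u] using ha) hv
  | succ k =>
    have ha0 : a 0 ≠ 0 := by
      intro h0
      refine hmin k k.lt_succ_self (fun i => σ.symm (a (i + 1))) (hf ?_)
      rw [hu, ha, Finset.sum_range_succ', h0, map_sum]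
      simp [hu]
    obtain ⟨y, hy0, hy⟩ := exists_ne_zero_eval_twistedCoeff_eq hq ha0 k
    let x : ℕ → K := fun i => (twistedCoeff q a i).eval y
    have hx0 : x 0 = a 0 * y ^ q := by simp [x, twistedCoeff]
    have hxs : ∀ i, x (i + 1) = x i ^ q + a (i + 1) * y ^ q := by simp [x, twistedCoeff]
    have hxk : x k = y := hy
    refine ⟨∑ i ∈ Finset.range (k + 1), x i • u i, fun h => ?_, ?_⟩
    · refine hmin k k.lt_succ_self (fun i => -(y⁻¹ * x i)) ?_
      rw [Finset.sum_range_succ, hxk, add_comm, add_eq_zero_iff_eq_neg] at h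
      rw [← inv_smul_smul₀ hy0 (u k), h, smul_neg, Finset.smul_sum, ← Finset.sum_neg_distrib]
      simp [mul_smul]
    · have h1 : f (∑ i ∈ Finset.range (k + 1), x i • u i)
          = ∑ i ∈ Finset.range k, x i ^ q • u (i + 1) + y ^ q • u (k + 1) := by
        simp [map_sum, Finset.sum_range_succ, hσ, hu, hxk]
      rw [h1, ha, Finset.sum_range_succ', Finset.sum_range_succ', hx0, smul_add, Finset.smul_sum,
        ← add_assoc, ← Finset.sum_add_distrib]
      simp only [hxs, add_smul, smul_smul, mul_comm]

theorem exists_map_eq_smul_of_frobenius_linear {K V : Type*} [Field K] [IsAlgClosed K]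
    {q : ℕ} (hq : 1 < q) (σ : K ≃+* K) (hσ : ∀ x, σ x = x ^ q)
    [AddCommGroup V] [Module K V] [FiniteDimensional K V] [Nontrivial V]
    (f : V →ₛₗ[(σ : K →+* K)] V) : ∃ v ≠ 0, ∃ c : K, f v = c • v := by
  by_cases hf : Function.Injective f
  · obtain ⟨v, hv, h⟩ := exists_fixed_of_injective_frobenius_linear hq σ hσ f hf
    exact ⟨v, hv, 1, by simpa using h⟩
  · rw [injective_iff_map_eq_zero] at hf
    push Not at hf
    obtain ⟨v, h, hv⟩ := hf
    exact ⟨v, hv, 0, by simpa using h⟩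

theorem surjective_of_injective_semilinear {K V : Type*} [Field K] (τ : K ≃+* K)
    [AddCommGroup V] [Module K V] [FiniteDimensional K V]
    (f : V →ₛₗ[(τ : K →+* K)] V) (hf : Function.Injective f) : Function.Surjective f := by
  let b := Module.finBasis K V
  have hli : LinearIndependent K (f ∘ b) :=
    b.linearIndependent.map_of_injective_injective τ.symm f.toAddMonoidHom
      (by simp) (fun m hm => hf (by simpa using hm)) (by simp)
  rw [← LinearMap.range_eq_top, eq_top_iff,
    ← hli.span_eq_top_of_card_eq_finrank' (by simp), Submodule.span_le]
  rintro _ ⟨i, rfl⟩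
  exact ⟨b i, rfl⟩

theorem exists_map_eq_smul_of_frobenius_symm_linear {K V : Type*} [Field K] [IsAlgClosed K]
    {q : ℕ} (hq : 1 < q) (σ : K ≃+* K) (hσ : ∀ x, σ x = x ^ q)
    [AddCommGroup V] [Module K V] [FiniteDimensional K V] [Nontrivial V]
    (f : V →ₛₗ[(σ.symm : K →+* K)] V) : ∃ v ≠ 0, ∃ c : K, f v = c • v := by
  by_cases hf : Function.Injective f
  · have := RingHomInvPair.of_ringEquiv σ
    have := RingHomInvPair.of_ringEquiv_symm σ
    let e := LinearEquiv.ofBijective f ⟨hf, surjective_of_injective_semilinear σ.symm f hf⟩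
    obtain ⟨v, hv, h⟩ := exists_fixed_of_injective_frobenius_linear hq σ hσ
      (e.symm : V →ₛₗ[(σ : K →+* K)] V) e.symm.injective
    refine ⟨v, hv, 1, ?_⟩
    rw [one_smul]
    exact (e.symm_apply_eq.1 h).symm
  · rw [injective_iff_map_eq_zero] at hf
    push Not at hf
    obtain ⟨v, h, hv⟩ := hf
    exact ⟨v, hv, 0, by simpa using h⟩

/-- If the map induced on `V ⧸ U` by a semilinear map has an eigenvector, the invariant subspace `U ≠ V`
can be enlarged to an invariant subspace of one dimension more. -/
theorem exists_invariant_finrank_succ {K V : Type*} [Field K] {τ : K →+* K}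
    [AddCommGroup V] [Module K V] [FiniteDimensional K V] (f : V →ₛₗ[τ] V)
    (U : Submodule K V) (hU : U ≤ U.comap f)
    (h : ∃ w : V ⧸ U, w ≠ 0 ∧ ∃ c : K, U.mapQ U f hU w = c • w) :
    ∃ U' : Submodule K V, U ≤ U' ∧ U' ≤ U'.comap f ∧
      Module.finrank K U' = Module.finrank K U + 1 := by
  obtain ⟨w, hw, c, hc⟩ := h
  obtain ⟨v, rfl⟩ := U.mkQ_surjective w
  have hvU : v ∉ U := by simpa using hw
  have hfv : f v - c • v ∈ U := by
    rw [← Submodule.Quotient.eq]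
    simpa using hc
  refine ⟨U ⊔ K ∙ v, le_sup_left, sup_le (hU.trans (Submodule.comap_mono le_sup_left)) ?_, ?_⟩
  · rw [Submodule.span_singleton_le_iff_mem, Submodule.mem_comap]
    rw [← sub_add_cancel (f v) (c • v)]
    exact Submodule.add_mem_sup hfv (Submodule.smul_mem _ _ (Submodule.mem_span_singleton_self v))
  · have hv0 : v ≠ 0 := fun h0 => hvU (h0 ▸ U.zero_mem)
    have hd : U ⊓ K ∙ v = ⊥ := ((Submodule.disjoint_span_singleton' hv0).2 hvU).eq_bot
    have := Submodule.finrank_sup_add_finrank_inf_eq U (K ∙ v)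
    rwa [hd, finrank_bot, add_zero, finrank_span_singleton hv0] at this

/-- If every `τ`-linear endomorphism of a nonzero quotient of `V` has an eigenvector, then every
`τ`-linear endomorphism of `V` has an invariant complete flag. -/
theorem exists_invariant_flag {K : Type*} {V : Type*} [Field K] {τ : K →+* K}
    [AddCommGroup V] [Module K V] [FiniteDimensional K V]
    (h : ∀ U : Submodule K V, U ≠ ⊤ → ∀ g : V ⧸ U →ₛₗ[τ] V ⧸ U, ∃ w ≠ 0, ∃ c : K, g w = c • w)
    (f : V →ₛₗ[τ] V) :
    ∃ Vc : ℕ → Submodule K V,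
      Vc 0 = ⊥ ∧
      Vc (Module.finrank K V) = ⊤ ∧
      (∀ i : ℕ, Vc i ≤ Vc (i + 1)) ∧
      (∀ i : ℕ, ∀ x ∈ Vc i, f x ∈ Vc i) ∧
      (∀ i : ℕ, i ≤ Module.finrank K V → Module.finrank K (Vc i) = i) := by
  have step : ∀ U : {U : Submodule K V // U ≤ U.comap f},
      ∃ U' : {U : Submodule K V // U ≤ U.comap f}, U.1 ≤ U'.1 ∧
        (U.1 ≠ ⊤ → Module.finrank K U'.1 = Module.finrank K U.1 + 1) := by
    rintro ⟨U, hU⟩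
    by_cases hT : U = ⊤
    · exact ⟨⟨U, hU⟩, le_rfl, fun hne => absurd hT hne⟩
    · obtain ⟨U', h1, h2, h3⟩ := exists_invariant_finrank_succ f U hU (h U hT _)
      exact ⟨⟨U', h2⟩, h1, fun _ => h3⟩
  choose next hle hrank using step
  let F : ℕ → {U : Submodule K V // U ≤ U.comap f} :=
    fun i => Nat.rec ⟨⊥, bot_le⟩ (fun _ => next) i
  have hF : ∀ i ≤ Module.finrank K V, Module.finrank K (F i).1 = i := by
    intro i
    induction i with
    | zero => exact fun _ => finrank_bot K V
    | succ i ih =>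
      intro hi
      have hFi := ih (by lia)
      have hne : (F i).1 ≠ ⊤ := by
        intro hT
        rw [hT, finrank_top] at hFi
        lia
      exact (hrank (F i) hne).trans (by rw [hFi])
  exact ⟨fun i => (F i).1, rfl, Submodule.eq_top_of_finrank_eq (hF _ le_rfl),
    fun i => hle (F i), fun i => (F i).2, hF⟩


/-- Let `k = 𝔽_q` (with `q = p ^ n`), `K = k̄` an algebraic closure of `k`,
and `σ : K ≃+* K` the Frobenius `x ↦ x ^ q`.  Let `τ` be either `σ` or `σ⁻¹`, let `V` be a
finite-dimensional `K`-vector space and `Φ : V → V` a `τ`-linear map.  Then there is a chain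
of `K`-subspaces `0 = V₀ ⊆ V₁ ⊆ ⋯ ⊆ V_r = V`, with `r = dim_K V`, such that `Φ(V_i) ⊆ V_i`
and `dim_K (V_i / V_{i-1}) = 1` for all `i = 1, …, r` (equivalently, `dim_K V_i = i`). -/
theorem tau_space_filtration_by_lines
    (p n : ℕ) [Fact p.Prime] (hn : n ≠ 0)
    (K : Type*) [Field K] [Algebra (GaloisField p n) K] [IsAlgClosure (GaloisField p n) K]
    (σ : K ≃+* K) (hσ : ∀ x : K, σ x = x ^ p ^ n)
    (V : Type*) [AddCommGroup V] [Module K V] [FiniteDimensional K V]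
    (Φ : V → V)
    (hadd : ∀ u v : V, Φ (u + v) = Φ u + Φ v)
    (hτ : (∀ (a : K) (v : V), Φ (a • v) = σ a • Φ v) ∨
          (∀ (a : K) (v : V), Φ (a • v) = σ.symm a • Φ v)) :
    ∃ Vc : ℕ → Submodule K V,
      Vc 0 = ⊥ ∧
      Vc (Module.finrank K V) = ⊤ ∧
      (∀ i : ℕ, Vc i ≤ Vc (i + 1)) ∧
      (∀ i : ℕ, ∀ x ∈ Vc i, Φ x ∈ Vc i) ∧
      (∀ i : ℕ, i ≤ Module.finrank K V → Module.finrank K (Vc i) = i) := by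
  have : IsAlgClosed K := IsAlgClosure.isAlgClosed (GaloisField p n)
  have hq : 1 < p ^ n := Nat.one_lt_pow hn (Fact.out : p.Prime).one_lt
  have hnt : ∀ U : Submodule K V, U ≠ ⊤ → Nontrivial (V ⧸ U) :=
    fun U => Submodule.Quotient.nontrivial_iff.2
  rcases hτ with hτ | hτ
  · refine exists_invariant_flag (τ := (σ : K →+* K)) (fun U hU g => ?_)
      { toFun := Φ, map_add' := hadd, map_smul' := hτ }
    have := hnt U hU
    exact exists_map_eq_smul_of_frobenius_linear hq σ hσ g
  · refine exists_invariant_flag (τ := (σ.symm : K →+* K)) (fun U hU g => ?_)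
      { toFun := Φ, map_add' := hadd, map_smul' := hτ }
    have := hnt U hU
    exact exists_map_eq_smul_of_frobenius_symm_linear hq σ hσ g
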